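/- Let λ, μ > 0 and N ≥ 2. Define ψ₁(v) = Σ_{i≠j} H₂(v_i)H₂(v_j) (sum over ordered pairs of distinct indices) and ψ₂(v) = Σ_{i=1}^N H₄(v_i). Then (λ𝓛_K + μ𝓛_T)ψ₁ = (μ + 3λ/(2(N−1))) ψ₁ − (λ/2) ψ₂ and (λ𝓛_K + μ𝓛_T)ψ₂ = −(3λ/(2(N−1))) ψ₁ + ((5/8)μ + λ/2) ψ₂; i.e. the span of ψ₁, ψ₂ is invariant under λ𝓛_K + μ𝓛_T, on which the operator acts, in the orthonormalized basis, by the symmetric matrix with diagonal entries μ + 3λ/(2(N−1)) and (5/8)μ + λ/2 and off-diagonal entries −√3 λ/(2√(N−1)). -/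

import Mathlib

open MeasureTheory Real
open scoped BigOperators

noncomputable section

/-- standard Gaussian density on ℝ -/
def g (v : ℝ) : ℝ := (Real.sqrt (2 * Real.pi))⁻¹ * Real.exp (-v ^ 2 / 2)

/-- product Gaussian density on ℝᴺ -/
def gam (N : ℕ) (v : Fin N → ℝ) : ℝ := ∏ i, g (v i)

/-- the Gaussian measure γ(v)dv on ℝᴺ -/
def gmeas (N : ℕ) : Measure (Fin N → ℝ) :=
  volume.withDensity (fun v => ENNReal.ofReal (gam N v))

/-- average over θ ∈ [0, 2π] -/
def avg (F : ℝ → ℝ) : ℝ := (2 * Real.pi)⁻¹ * ∫ θ in (0:ℝ)..(2 * Real.pi), F θ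

/-- v with coordinates i,j rotated by angle θ -/
def rot (N : ℕ) (v : Fin N → ℝ) (i j : Fin N) (θ : ℝ) : Fin N → ℝ :=
  Function.update (Function.update v i (v i * Real.cos θ + v j * Real.sin θ)) j
    (-(v i) * Real.sin θ + v j * Real.cos θ)

/-- the Kac collision operator Q -/
def Qop (N : ℕ) (h : (Fin N → ℝ) → ℝ) (v : Fin N → ℝ) : ℝ :=
  ((N.choose 2 : ℝ))⁻¹ * ∑ i : Fin N, ∑ j : Fin N,
    if i < j then avg (fun θ => h (rot N v i j θ)) else 0

/-- 𝓛_K = N (I - Q) -/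
def LK (N : ℕ) (h : (Fin N → ℝ) → ℝ) (v : Fin N → ℝ) : ℝ :=
  (N : ℝ) * (h v - Qop N h v)

/-- v with j-th coordinate replaced by v_j cos θ + w sin θ -/
def rotw (N : ℕ) (v : Fin N → ℝ) (j : Fin N) (θ w : ℝ) : Fin N → ℝ :=
  Function.update v j (v j * Real.cos θ + w * Real.sin θ)

/-- the thermostat operator T_j -/
def Tj (N : ℕ) (j : Fin N) (h : (Fin N → ℝ) → ℝ) (v : Fin N → ℝ) : ℝ :=
  ∫ w : ℝ, g w * avg (fun θ => h (rotw N v j θ w))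

/-- 𝓛_T = Σ_j (I - T_j) -/
def LTherm (N : ℕ) (h : (Fin N → ℝ) → ℝ) (v : Fin N → ℝ) : ℝ :=
  ∑ j : Fin N, (h v - Tj N j h v)

/-- inner product on L²(ℝᴺ, γ dv) -/
def iprod (N : ℕ) (h₁ h₂ : (Fin N → ℝ) → ℝ) : ℝ :=
  ∫ v : Fin N → ℝ, h₁ v * h₂ v * gam N v

/-- probabilist's Hermite polynomial H_α(v) = (−1)ᵅ e^{v²/2} (d/dv)ᵅ e^{−v²/2} -/
def Herm (n : ℕ) (v : ℝ) : ℝ :=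
  (-1 : ℝ) ^ n * Real.exp (v ^ 2 / 2) * iteratedDeriv n (fun x => Real.exp (-x ^ 2 / 2)) v

/-- s_n = (2π)⁻¹ ∫₀^{2π} cosⁿ θ dθ -/
def sCoef (n : ℕ) : ℝ := avg (fun θ => Real.cos θ ^ n)

/-- the master-equation thermostat operator R_j acting on densities -/
def Rop (N : ℕ) (j : Fin N) (f : (Fin N → ℝ) → ℝ) (v : Fin N → ℝ) : ℝ :=
  ∫ w : ℝ, avg (fun θ =>
    g (-(v j) * Real.sin θ + w * Real.cos θ) * f (rotw N v j θ w))

/-- relative entropy S(f|γ) -/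
def relEnt (N : ℕ) (f : (Fin N → ℝ) → ℝ) : ℝ :=
  ∫ v : Fin N → ℝ, f v * Real.log (f v / gam N v)

lemma herm_eq_aeval_hermite (n : ℕ) (x : ℝ) :
    Herm n x = Polynomial.aeval x (Polynomial.hermite n) := by
  rw [Polynomial.hermite_eq_deriv_gaussian', Herm, iteratedDeriv_eq_iterate]
  simp only [neg_div]
  ring

lemma herm_two (x : ℝ) : Herm 2 x = x ^ 2 - 1 := by
  simp [herm_eq_aeval_hermite, Polynomial.hermite_succ]
  ring

lemma herm_four (x : ℝ) : Herm 4 x = x ^ 4 - 6 * x ^ 2 + 3 := by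
  simp [herm_eq_aeval_hermite, Polynomial.hermite_succ]
  ring

lemma avg_quartic_form (A B C D E F : ℝ) :
    avg (fun θ => A * cos θ ^ 4 + B * (cos θ ^ 3 * sin θ) + C * (cos θ ^ 2 * sin θ ^ 2)
      + D * (cos θ * sin θ ^ 3) + E * sin θ ^ 4 + F)
      = 3 / 8 * A + C / 8 + 3 / 8 * E + F := by
  have hderiv : ∀ θ ∈ Set.uIcc 0 (2 * π), HasDerivAt (fun θ =>
      A * (3 / 8 * θ + 3 / 8 * (sin θ * cos θ) + sin θ * cos θ ^ 3 / 4)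
      - B * cos θ ^ 4 / 4
      + C * (θ / 8 + sin θ * cos θ / 8 - sin θ * cos θ ^ 3 / 4)
      + D * sin θ ^ 4 / 4
      + E * (3 / 8 * θ - 3 / 8 * (sin θ * cos θ) - sin θ ^ 3 * cos θ / 4) + F * θ)
      (A * cos θ ^ 4 + B * (cos θ ^ 3 * sin θ) + C * (cos θ ^ 2 * sin θ ^ 2)
      + D * (cos θ * sin θ ^ 3) + E * sin θ ^ 4 + F) θ := by
    intro θ _
    have hs := hasDerivAt_sin θ
    have hc := hasDerivAt_cos θ
    have hi := hasDerivAt_id' θ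
    have hsc := hs.mul hc
    have := ((((((((hi.const_mul (3 / 8)).add (hsc.const_mul (3 / 8))).add
      ((hs.mul (hc.pow 3)).div_const 4)).const_mul A).sub
      (((hc.pow 4).const_mul B).div_const 4)).add
      ((((hi.div_const 8).add (hsc.div_const 8)).sub
        ((hs.mul (hc.pow 3)).div_const 4)).const_mul C)).add
      (((hs.pow 4).const_mul D).div_const 4)).add
      ((((hi.const_mul (3 / 8)).sub (hsc.const_mul (3 / 8))).sub
        (((hs.pow 3).mul hc).div_const 4)).const_mul E)).add (hi.const_mul F)
    refine this.congr_deriv ?_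
    have hs2 : sin θ ^ 2 = 1 - cos θ ^ 2 := sin_sq θ
    have hs4 : sin θ ^ 4 = (1 - cos θ ^ 2) ^ 2 := by rw [← hs2]; ring
    simp only [Nat.cast_ofNat, Nat.reduceSub, Pi.pow_apply]
    ring_nf
    simp only [hs2, hs4]
    ring
  rw [avg, intervalIntegral.integral_eq_sub_of_hasDerivAt hderiv
    (Continuous.intervalIntegrable (by fun_prop) _ _)]
  simp only [sin_two_pi, cos_two_pi, sin_zero, cos_zero]
  field_simp [Real.pi_ne_zero]
  ring

lemma g_eq (w : ℝ) : g w = (√(2 * π))⁻¹ * exp (-(1 / 2) * w ^ 2) := by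
  rw [g]
  ring_nf

lemma integrable_pow_mul_g (n : ℕ) : Integrable (fun w : ℝ => w ^ n * g w) := by
  have h := integrable_rpow_mul_exp_neg_mul_sq (b := 1 / 2) (by norm_num) (s := (n : ℝ))
    (by linarith [Nat.cast_nonneg (α := ℝ) n])
  refine (h.const_mul (√(2 * π))⁻¹).congr (ae_of_all _ fun w => ?_)
  simp only [rpow_natCast, g_eq]
  ring

lemma hasDerivAt_g (w : ℝ) : HasDerivAt g (-w * g w) w := by
  have h := (((((hasDerivAt_id' w).pow 2).neg).div_const 2).exp).const_mul (√(2 * π))⁻¹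
  refine h.congr_deriv ?_
  simp [g]
  ring

lemma integral_g : ∫ w, g w = 1 := by
  simp only [g_eq]
  rw [integral_const_mul, integral_gaussian, show π / (1 / 2) = 2 * π by ring]
  exact inv_mul_cancel₀ (by positivity)

lemma integral_pow_add_two_mul_g (n : ℕ) :
    ∫ w, w ^ (n + 2) * g w = (n + 1) * ∫ w, w ^ n * g w := by
  have hd (w : ℝ) : HasDerivAt (fun w => w ^ (n + 1) * g w)
      ((n + 1) * (w ^ n * g w) - w ^ (n + 2) * g w) w := by
    refine (((hasDerivAt_id' w).pow (n + 1)).mul (hasDerivAt_g w)).congr_deriv ?_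
    simp
    ring
  have h := integral_eq_zero_of_hasDerivAt_of_integrable hd
    (((integrable_pow_mul_g n).const_mul _).sub (integrable_pow_mul_g (n + 2)))
    (integrable_pow_mul_g (n + 1))
  rw [integral_sub ((integrable_pow_mul_g n).const_mul _) (integrable_pow_mul_g (n + 2)),
    integral_const_mul] at h
  linarith

lemma integral_g_mul_even_quartic (A B C : ℝ) :
    ∫ w, g w * (A * w ^ 4 + B * w ^ 2 + C) = 3 * A + B + C := by
  have h2 := integral_pow_add_two_mul_g 0
  have h4 := integral_pow_add_two_mul_g 2
  simp only [pow_zero, one_mul, integral_g, zero_add] at h2 h4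
  have hrw : (fun w => g w * (A * w ^ 4 + B * w ^ 2 + C))
      = fun w => A * (w ^ 4 * g w) + B * (w ^ 2 * g w) + C * (w ^ 0 * g w) := by
    ext w
    ring
  have i0 := (integrable_pow_mul_g 0).const_mul C
  have i2 := (integrable_pow_mul_g 2).const_mul B
  have i4 := (integrable_pow_mul_g 4).const_mul A
  have i42 : Integrable (fun w : ℝ => A * (w ^ 4 * g w) + B * (w ^ 2 * g w)) := i4.add i2
  rw [hrw, integral_add i42 i0, integral_add i4 i2, integral_const_mul,
    integral_const_mul, integral_const_mul, h4, h2]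
  simp only [pow_zero, one_mul, integral_g]
  push_cast
  ring

/-- The symmetric even quartic polynomial `a Σ uᵢ⁴ + b (Σ uᵢ²)² + c Σ uᵢ² + d`. -/
def symQuartic (N : ℕ) (a b c d : ℝ) (u : Fin N → ℝ) : ℝ :=
  a * ∑ i, u i ^ 4 + b * (∑ i, u i ^ 2) ^ 2 + c * ∑ i, u i ^ 2 + d

lemma sum_comp_update {N : ℕ} (F : ℝ → ℝ) (u : Fin N → ℝ) (j : Fin N) (x : ℝ) :
    ∑ k, F (Function.update u j x k) = ∑ k, F (u k) - F (u j) + F x := by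
  rw [← Finset.add_sum_erase _ _ (Finset.mem_univ j),
    ← Finset.add_sum_erase Finset.univ (fun k => F (u k)) (Finset.mem_univ j),
    Finset.sum_congr rfl fun k hk => by rw [Function.update_of_ne (Finset.ne_of_mem_erase hk)]]
  simp
  ring

lemma sum_comp_rot {N : ℕ} (F : ℝ → ℝ) (v : Fin N → ℝ) {i j : Fin N} (hij : i ≠ j) (θ : ℝ) :
    ∑ k, F (rot N v i j θ k) = ∑ k, F (v k) - F (v i) - F (v j)
      + F (v i * cos θ + v j * sin θ) + F (-(v i) * sin θ + v j * cos θ) := by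
  rw [rot, sum_comp_update, sum_comp_update, Function.update_of_ne hij.symm]
  ring

lemma symQuartic_rot {N : ℕ} (a b c d : ℝ) (v : Fin N → ℝ) {i j : Fin N} (hij : i ≠ j) (θ : ℝ) :
    symQuartic N a b c d (rot N v i j θ) = symQuartic N a b c d v
      + a * ((v i * cos θ + v j * sin θ) ^ 4 + (-(v i) * sin θ + v j * cos θ) ^ 4
        - v i ^ 4 - v j ^ 4) := by
  have h2 : ∑ k, rot N v i j θ k ^ 2 = ∑ k, v k ^ 2 := by
    rw [sum_comp_rot (· ^ 2) v hij]
    linear_combination (v i ^ 2 + v j ^ 2) * sin_sq_add_cos_sq θ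
  rw [symQuartic, symQuartic, h2, sum_comp_rot (· ^ 4) v hij]
  ring

lemma avg_symQuartic_rot {N : ℕ} (a b c d : ℝ) (v : Fin N → ℝ) {i j : Fin N} (hij : i ≠ j) :
    avg (fun θ => symQuartic N a b c d (rot N v i j θ)) = symQuartic N a b c d v
      - a * (v i ^ 4 / 4 + v j ^ 4 / 4 - 3 / 2 * (v i ^ 2 * v j ^ 2)) := by
  have h := avg_quartic_form (a * (v i ^ 4 + v j ^ 4))
    (a * (4 * v i ^ 3 * v j - 4 * v i * v j ^ 3)) (a * (12 * v i ^ 2 * v j ^ 2))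
    (a * (4 * v i * v j ^ 3 - 4 * v i ^ 3 * v j)) (a * (v i ^ 4 + v j ^ 4))
    (symQuartic N a b c d v - a * (v i ^ 4 + v j ^ 4))
  convert h using 2
  · ext θ
    rw [symQuartic_rot a b c d v hij]
    ring
  · ring

lemma two_mul_sum_lt {N : ℕ} (f : Fin N → Fin N → ℝ) (hf : ∀ i j, f i j = f j i) :
    2 * ∑ i, ∑ j, (if i < j then f i j else 0) = ∑ i, ∑ j, f i j - ∑ i, f i i := by
  have hswap : ∑ i, ∑ j, (if i < j then f i j else 0)
      = ∑ i, ∑ j, (if j < i then f i j else 0) := by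
    rw [Finset.sum_comm]
    simp only [hf]
  have hdiag : ∑ i, f i i = ∑ i, ∑ j, (if i = j then f i j else 0) := by simp
  have hsplit : ∑ i, ∑ j, f i j = ∑ i, ∑ j, (if i < j then f i j else 0)
      + ∑ i, ∑ j, (if j < i then f i j else 0) + ∑ i, ∑ j, (if i = j then f i j else 0) := by
    simp only [← Finset.sum_add_distrib]
    refine Finset.sum_congr rfl fun i _ => Finset.sum_congr rfl fun j _ => ?_
    rcases lt_trichotomy i j with h | h | h
    · simp [h, h.not_gt, h.ne]
    · simp [h]
    · simp [h, h.not_gt, h.ne']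
  linarith

lemma LK_symQuartic {N : ℕ} (hN : 2 ≤ N) (a b c d : ℝ) (v : Fin N → ℝ) :
    LK N (symQuartic N a b c d) v
      = a * (N * (∑ i, v i ^ 4) / 2 + ∑ i, v i ^ 4 - 3 / 2 * (∑ i, v i ^ 2) ^ 2) / (N - 1) := by
  set f : Fin N → Fin N → ℝ := fun i j =>
    v i ^ 4 / 4 + v j ^ 4 / 4 - 3 / 2 * (v i ^ 2 * v j ^ 2) with hf
  have hsum : ∑ i, ∑ j, f i j = N * (∑ i, v i ^ 4) / 2 - 3 / 2 * (∑ i, v i ^ 2) ^ 2 := by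
    simp only [hf, Finset.sum_sub_distrib, Finset.sum_add_distrib, Finset.sum_const,
      Finset.card_univ, Fintype.card_fin, nsmul_eq_mul, ← Finset.mul_sum, ← Finset.sum_mul,
      ← Finset.sum_div]
    ring
  have hdiag : ∑ i, f i i = -∑ i, v i ^ 4 := by
    rw [← Finset.sum_neg_distrib]
    exact Finset.sum_congr rfl fun i _ => by simp only [hf]; ring
  have h1 := two_mul_sum_lt f fun i j => by simp only [hf]; ring
  have hcount := two_mul_sum_lt (fun _ _ : Fin N => (1 : ℝ)) fun _ _ => rfl
  simp only [Finset.sum_const, Finset.card_univ, Fintype.card_fin, nsmul_eq_mul, mul_one] at hcount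
  have hQ : ∑ i, ∑ j, (if i < j then avg (fun θ => symQuartic N a b c d (rot N v i j θ)) else 0)
      = symQuartic N a b c d v * ∑ i : Fin N, ∑ j : Fin N, (if i < j then (1 : ℝ) else 0)
        - a * ∑ i, ∑ j, (if i < j then f i j else 0) := by
    simp only [Finset.mul_sum, ← Finset.sum_sub_distrib]
    refine Finset.sum_congr rfl fun i _ => Finset.sum_congr rfl fun j _ => ?_
    split_ifs with h
    · rw [avg_symQuartic_rot a b c d v h.ne]
      ring
    · ring
  have hN' : (2 : ℝ) ≤ N := by exact_mod_cast hN
  have h0 : (N : ℝ) ≠ 0 := by positivity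
  have h1' : (N : ℝ) - 1 ≠ 0 := by linarith
  rw [hsum, hdiag] at h1
  rw [LK, Qop, hQ, Nat.cast_choose_two, eq_div_of_mul_eq two_ne_zero ((mul_comm _ _).trans h1),
    eq_div_of_mul_eq two_ne_zero ((mul_comm _ _).trans hcount)]
  field_simp
  ring

lemma symQuartic_rotw {N : ℕ} (a b c d : ℝ) (v : Fin N → ℝ) (j : Fin N) (θ w : ℝ) :
    symQuartic N a b c d (rotw N v j θ w)
      = a * (∑ i, v i ^ 4 - v j ^ 4 + (v j * cos θ + w * sin θ) ^ 4)
        + b * (∑ i, v i ^ 2 - v j ^ 2 + (v j * cos θ + w * sin θ) ^ 2) ^ 2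
        + c * (∑ i, v i ^ 2 - v j ^ 2 + (v j * cos θ + w * sin θ) ^ 2) + d := by
  rw [symQuartic, rotw, sum_comp_update (· ^ 4), sum_comp_update (· ^ 2)]

lemma avg_even_quartic (A B C x y : ℝ) :
    avg (fun θ => A * (x * cos θ + y * sin θ) ^ 4 + B * (x * cos θ + y * sin θ) ^ 2 + C)
      = A * (3 / 8 * x ^ 4 + 3 / 4 * (x ^ 2 * y ^ 2) + 3 / 8 * y ^ 4)
        + B * (x ^ 2 + y ^ 2) / 2 + C := by
  have h := avg_quartic_form (A * x ^ 4 + B * x ^ 2) (A * (4 * x ^ 3 * y) + B * (2 * x * y))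
    (A * (6 * x ^ 2 * y ^ 2) + B * (x ^ 2 + y ^ 2)) (A * (4 * x * y ^ 3) + B * (2 * x * y))
    (A * y ^ 4 + B * y ^ 2) C
  convert h using 2
  · ext θ
    linear_combination (-B * (x * cos θ + y * sin θ) ^ 2) * sin_sq_add_cos_sq θ
  · ring

lemma Tj_symQuartic {N : ℕ} (a b c d : ℝ) (v : Fin N → ℝ) (j : Fin N) :
    Tj N j (symQuartic N a b c d) v = symQuartic N a b c d v
      - (a + b) * v j ^ 4 + (a + b) * (3 / 8 * v j ^ 4 + 3 / 4 * v j ^ 2 + 9 / 8)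
      + (2 * b * (∑ i, v i ^ 2 - v j ^ 2) + c) * (1 - v j ^ 2) / 2 := by
  set R := ∑ i, v i ^ 2 - v j ^ 2 with hR
  set K := a * (∑ i, v i ^ 4 - v j ^ 4) + b * R ^ 2 + c * R + d with hK
  have havg (w : ℝ) : avg (fun θ => symQuartic N a b c d (rotw N v j θ w))
      = (3 / 8 * (a + b)) * w ^ 4
        + (3 / 4 * (a + b) * v j ^ 2 + (2 * b * R + c) / 2) * w ^ 2
        + (3 / 8 * (a + b) * v j ^ 4 + (2 * b * R + c) * v j ^ 2 / 2 + K) := by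
    have h := avg_even_quartic (a + b) (2 * b * R + c) K (v j) w
    refine (congrArg avg (funext fun θ => ?_)).trans (h.trans ?_)
    · rw [symQuartic_rotw, ← hR, hK]
      ring
    · ring
  simp only [Tj, havg]
  rw [integral_g_mul_even_quartic, symQuartic, hK, show ∑ i, v i ^ 2 = R + v j ^ 2 by rw [hR]; ring]
  ring

lemma LTherm_symQuartic {N : ℕ} (a b c d : ℝ) (v : Fin N → ℝ) :
    LTherm N (symQuartic N a b c d) v
      = (5 / 8 * (a + b) - b) * ∑ i, v i ^ 4 - 3 / 4 * (a + b) * ∑ i, v i ^ 2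
        - 9 / 8 * (a + b) * N + b * (∑ i, v i ^ 2) ^ 2 - b * (N - 1) * ∑ i, v i ^ 2
        + c * (∑ i, v i ^ 2 - N) / 2 := by
  have h (j : Fin N) : symQuartic N a b c d v - Tj N j (symQuartic N a b c d) v
      = (5 / 8 * (a + b) - b) * v j ^ 4
        + (-(3 / 4) * (a + b) + b * ∑ i, v i ^ 2 + b + c / 2) * v j ^ 2
        + (-(9 / 8) * (a + b) - b * ∑ i, v i ^ 2 - c / 2) := by
    rw [Tj_symQuartic]
    ring
  simp only [LTherm, h, Finset.sum_add_distrib, ← Finset.mul_sum, Finset.sum_const,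
    Finset.card_univ, Fintype.card_fin, nsmul_eq_mul]
  ring

lemma sum_ne_mul {N : ℕ} (x : Fin N → ℝ) :
    ∑ i, ∑ j, (if i ≠ j then x i * x j else 0) = (∑ i, x i) ^ 2 - ∑ i, x i ^ 2 := by
  have h (i j : Fin N) : (if i ≠ j then x i * x j else 0)
      = x i * x j - if i = j then x i * x j else 0 := by
    split_ifs <;> simp_all
  simp only [h, Finset.sum_sub_distrib, Finset.sum_ite_eq, Finset.mem_univ, if_true,
    ← Finset.mul_sum, ← Finset.sum_mul]
  simp only [pow_two]

lemma sum_herm_two_mul_herm_two {N : ℕ} (u : Fin N → ℝ) :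
    ∑ i, ∑ j, (if i ≠ j then Herm 2 (u i) * Herm 2 (u j) else 0)
      = symQuartic N (-1) 1 (2 - 2 * N) (N ^ 2 - N) u := by
  have h (i : Fin N) : (u i ^ 2 - 1) ^ 2 = u i ^ 4 - 2 * u i ^ 2 + 1 := by ring
  rw [sum_ne_mul fun i => Herm 2 (u i)]
  simp only [herm_two, h, symQuartic, Finset.sum_add_distrib, Finset.sum_sub_distrib,
    ← Finset.mul_sum, Finset.sum_const, Finset.card_univ, Fintype.card_fin, nsmul_eq_mul]
  ring

lemma sum_herm_four {N : ℕ} (u : Fin N → ℝ) :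
    ∑ i, Herm 4 (u i) = symQuartic N 1 0 (-6) (3 * N) u := by
  simp only [herm_four, symQuartic, Finset.sum_add_distrib, Finset.sum_sub_distrib,
    ← Finset.mul_sum, Finset.sum_const, Finset.card_univ, Fintype.card_fin, nsmul_eq_mul]
  ring

/-- action of λ𝓛_K + μ𝓛_T on the span of
ψ₁ = Σ_{i≠j} H₂(v_i)H₂(v_j) and ψ₂ = Σ_i H₄(v_i). -/
theorem action_on_L4_symmetric_span (N : ℕ) (hN : 2 ≤ N) (lam mu : ℝ)
    (hlam : 0 < lam) (hmu : 0 < mu) :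
    (∀ v : Fin N → ℝ,
      lam * LK N (fun u => ∑ i : Fin N, ∑ j : Fin N,
          if i ≠ j then Herm 2 (u i) * Herm 2 (u j) else 0) v
        + mu * LTherm N (fun u => ∑ i : Fin N, ∑ j : Fin N,
          if i ≠ j then Herm 2 (u i) * Herm 2 (u j) else 0) v
      = (mu + 3 * lam / (2 * ((N : ℝ) - 1)))
          * (∑ i : Fin N, ∑ j : Fin N, if i ≠ j then Herm 2 (v i) * Herm 2 (v j) else 0)
        - (lam / 2) * (∑ i : Fin N, Herm 4 (v i)))
    ∧ (∀ v : Fin N → ℝ,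
      lam * LK N (fun u => ∑ i : Fin N, Herm 4 (u i)) v
        + mu * LTherm N (fun u => ∑ i : Fin N, Herm 4 (u i)) v
      = -(3 * lam / (2 * ((N : ℝ) - 1)))
          * (∑ i : Fin N, ∑ j : Fin N, if i ≠ j then Herm 2 (v i) * Herm 2 (v j) else 0)
        + ((5 / 8) * mu + lam / 2) * (∑ i : Fin N, Herm 4 (v i))) := by
  have hN' : (2 : ℝ) ≤ N := by exact_mod_cast hN
  have h1 : (N : ℝ) - 1 ≠ 0 := by linarith
  simp only [sum_herm_two_mul_herm_two, sum_herm_four]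
  constructor <;> intro v <;> rw [LK_symQuartic hN, LTherm_symQuartic] <;>
    simp only [symQuartic] <;> field_simp <;> ring

end
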